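/- arXiv:0910.5261 — 8 statements merged into one kernel-verified Lean document; each statement's English description precedes it below -/
import Mathlib

section
/- Suppose M* is an n×m real matrix with M*ᵀM* = I_m such that for every n×m real matrix M with MᵀM = I_m one has det(I_m + (Mᵀ Λ̂p M)⁻¹) ≤ det(I_m + (M*ᵀ Λ̂p M*)⁻¹). Let E be an arbitrary m×m real orthogonal matrix and D an arbitrary m×m diagonal matrix with positive diagonal entries, and set T* := E D M*ᵀ Upᵀ Λ⁻¹ Fᵀ. Then rank T* = m and for every m×n real matrix T with rank T = m one has det(I_m + (1/2)·W(T)) ≤ det(I_m + (1/2)·W(T*)). -/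
open Matrix

/-- `W(S) := S Σx (Σx + Σe − Σx Sᵀ (S Σx Sᵀ)⁻¹ S Σx)⁻¹ Σx Sᵀ (S Σx Sᵀ)⁻¹`. -/
noncomputable def Wmat {m n : ℕ} (Sx Se : Matrix (Fin n) (Fin n) ℝ)
    (S : Matrix (Fin m) (Fin n) ℝ) : Matrix (Fin m) (Fin m) ℝ :=
  S * Sx * (Sx + Se - Sx * Sᵀ * (S * Sx * Sᵀ)⁻¹ * S * Sx)⁻¹ * Sx * Sᵀ * (S * Sx * Sᵀ)⁻¹

/-- If `T H = R Mᵀ` with `M` having orthonormal columns, `Σx = H Hᵀ` and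
`Σx + Σe = H Q Hᵀ`, then `I + W(T) / 2` is similar to `(I + (Mᵀ (I − Q⁻¹) M)⁻¹) / 2`. -/
theorem det_one_add_half_Wmat {m n : ℕ} {Sx Se H H' Q : Matrix (Fin n) (Fin n) ℝ}
    (hSe : Se.PosDef) (hH : H * H' = 1) (hx : Sx = H * Hᵀ) (hxe : Sx + Se = H * Q * Hᵀ)
    {T : Matrix (Fin m) (Fin n) ℝ} {M : Matrix (Fin n) (Fin m) ℝ} (hM : Mᵀ * M = 1)
    {R R' : Matrix (Fin m) (Fin m) ℝ} (hR : R * R' = 1) (hT : T * H = R * Mᵀ) :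
    ((1 : Matrix (Fin m) (Fin m) ℝ) + (1 / 2 : ℝ) • Wmat Sx Se T).det
      = (1 / 2 : ℝ) ^ m * ((1 : Matrix (Fin m) (Fin m) ℝ) + (Mᵀ * (1 - Q⁻¹) * M)⁻¹).det := by
  have hH' : H' * H = 1 := mul_eq_one_comm.mp hH
  have hR' : R' * R = 1 := mul_eq_one_comm.mp hR
  have hHt : Hᵀ * H'ᵀ = 1 := by rw [← transpose_mul, hH', transpose_one]
  have hRt : Rᵀ * R'ᵀ = 1 := by rw [← transpose_mul, hR', transpose_one]
  have hTt : Hᵀ * Tᵀ = M * Rᵀ := by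
    rw [← transpose_mul, hT, transpose_mul, transpose_transpose]
  have hinj : Function.Injective H'.vecMul :=
    Function.LeftInverse.injective (g := H.vecMul) fun v ↦ by simp [vecMul_vecMul, hH']
  have hQ1 : (Q - 1).PosDef := by
    have h : Q - 1 = H' * Se * H'ᵀ := by
      have : Se = H * (Q - 1) * Hᵀ := by
        rw [mul_sub, sub_mul, ← hxe, mul_one, ← hx, add_sub_cancel_left]
      rw [this]
      calc Q - 1 = (H' * H) * (Q - 1) * (Hᵀ * H'ᵀ) := by simp [hH', hHt]
        _ = _ := by simp only [mul_assoc]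
    rw [h, ← conjTranspose_eq_transpose_of_trivial]
    exact hSe.mul_mul_conjTranspose_same hinj
  have hproj : (1 - M * Mᵀ).PosSemidef := by
    have h : 1 - M * Mᵀ = (1 - M * Mᵀ)ᴴ * (1 - M * Mᵀ) := by
      have : M * Mᵀ * (M * Mᵀ) = M * Mᵀ := by
        rw [Matrix.mul_assoc, ← Matrix.mul_assoc Mᵀ, hM, Matrix.one_mul]
      simp [conjTranspose_eq_transpose_of_trivial, sub_mul, mul_sub, this]
    rw [h]
    exact posSemidef_conjTranspose_mul_self _
  have hdiff : (Q - M * Mᵀ).PosDef := by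
    simpa using hQ1.add_posSemidef hproj
  have hQ : Q.PosDef := by simpa using hQ1.add PosDef.one
  have hQu : Q⁻¹ * Q = 1 := nonsing_inv_mul _ ((isUnit_iff_isUnit_det _).mp hQ.isUnit)
  have hZ : (Q - M * Mᵀ) * (Q - M * Mᵀ)⁻¹ = 1 :=
    mul_nonsing_inv _ ((isUnit_iff_isUnit_det _).mp hdiff.isUnit)
  set Z := (Q - M * Mᵀ)⁻¹
  have hK : T * Sx * Tᵀ = R * Rᵀ := by
    calc T * Sx * Tᵀ = (T * H) * (Hᵀ * Tᵀ) := by rw [hx]; simp only [Matrix.mul_assoc]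
      _ = R * (Mᵀ * M) * Rᵀ := by rw [hT, hTt]; simp only [Matrix.mul_assoc]
      _ = _ := by rw [hM, mul_one]
  have hKinv : (T * Sx * Tᵀ)⁻¹ = R'ᵀ * R' := by
    rw [hK]
    refine inv_eq_right_inv ?_
    rw [mul_assoc, ← mul_assoc Rᵀ, hRt, one_mul, hR]
  have hin : (Sx + Se - Sx * Tᵀ * (T * Sx * Tᵀ)⁻¹ * T * Sx)⁻¹ = H'ᵀ * Z * H' := by
    have h : Sx + Se - Sx * Tᵀ * (T * Sx * Tᵀ)⁻¹ * T * Sx = H * (Q - M * Mᵀ) * Hᵀ := by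
      have : Sx * Tᵀ * (T * Sx * Tᵀ)⁻¹ * T * Sx = H * (M * Mᵀ) * Hᵀ := by
        calc _ = H * (Hᵀ * Tᵀ) * (R'ᵀ * R') * (T * H) * Hᵀ := by
              rw [hKinv, hx]; simp only [Matrix.mul_assoc]
          _ = H * M * (Rᵀ * R'ᵀ) * (R' * R) * Mᵀ * Hᵀ := by
              rw [hT, hTt]; simp only [Matrix.mul_assoc]
          _ = _ := by rw [hRt, hR']; simp only [Matrix.mul_assoc, Matrix.one_mul]
      rw [this, hxe, mul_sub, sub_mul]
    rw [h]
    refine inv_eq_right_inv ?_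
    calc H * (Q - M * Mᵀ) * Hᵀ * (H'ᵀ * Z * H')
        = H * (Q - M * Mᵀ) * (Hᵀ * H'ᵀ) * Z * H' := by simp only [mul_assoc]
      _ = H * ((Q - M * Mᵀ) * Z) * H' := by rw [hHt]; simp only [mul_assoc, one_mul]
      _ = 1 := by rw [hZ, mul_one, hH]
  have hW : Wmat Sx Se T = R * (Mᵀ * Z * M) * R' := by
    unfold Wmat
    rw [hin, hKinv]
    calc _ = (T * H) * (Hᵀ * H'ᵀ) * Z * (H' * H) * (Hᵀ * Tᵀ) * (R'ᵀ * R') := by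
          rw [hx]; simp only [Matrix.mul_assoc]
      _ = R * Mᵀ * Z * M * (Rᵀ * R'ᵀ) * R' := by
          rw [hT, hTt, hHt, hH']; simp only [Matrix.mul_assoc, Matrix.one_mul]
      _ = _ := by rw [hRt]; simp only [Matrix.mul_assoc, Matrix.one_mul]
  have hwood : (Mᵀ * (1 - Q⁻¹) * M)⁻¹ = 1 + Mᵀ * Z * M := by
    refine inv_eq_right_inv ?_
    have h1 : Q⁻¹ * (M * Mᵀ) * Z = Z - Q⁻¹ := by
      calc Q⁻¹ * (M * Mᵀ) * Z
          = (Q⁻¹ * Q) * Z - Q⁻¹ * ((Q - M * Mᵀ) * Z) := by noncomm_ring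
        _ = _ := by rw [hQu, hZ, one_mul, mul_one]
    have h2 : Mᵀ * Q⁻¹ * M * (Mᵀ * Z * M) = Mᵀ * Z * M - Mᵀ * Q⁻¹ * M := by
      calc _ = Mᵀ * (Q⁻¹ * (M * Mᵀ) * Z) * M := by simp only [Matrix.mul_assoc]
        _ = _ := by rw [h1, Matrix.mul_sub, Matrix.sub_mul]
    rw [Matrix.mul_sub, Matrix.sub_mul, Matrix.mul_one, hM, sub_mul, mul_add, mul_add, h2]
    simp
  have hsim : (1 : Matrix (Fin m) (Fin m) ℝ) + (1 / 2 : ℝ) • Wmat Sx Se T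
      = R * ((1 / 2 : ℝ) • (1 + (1 + Mᵀ * Z * M))) * R' := by
    have h : (1 / 2 : ℝ) • (1 + (1 + Mᵀ * Z * M)) = 1 + (1 / 2 : ℝ) • (Mᵀ * Z * M) := by
      module
    rw [hW, h, mul_add, add_mul, mul_one, hR, mul_smul_comm, smul_mul_assoc]
  rw [hwood, hsim, det_mul, det_mul, mul_right_comm, ← det_mul, hR, det_one, one_mul,
    det_smul, Fintype.card_fin]

open scoped MatrixOrder Matrix.Norms.L2Operator in
/-- A matrix of full row rank factors, after multiplication by `H`, as an invertible matrix times
a matrix with orthonormal rows. -/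
theorem exists_mul_transpose_of_rank_eq {m n : ℕ} {H : Matrix (Fin n) (Fin n) ℝ}
    (hH : (H * Hᵀ).PosDef) {T : Matrix (Fin m) (Fin n) ℝ} (hT : T.rank = m) :
    ∃ (M : Matrix (Fin n) (Fin m) ℝ) (R R' : Matrix (Fin m) (Fin m) ℝ),
      Mᵀ * M = 1 ∧ R * R' = 1 ∧ T * H = R * Mᵀ := by
  have hrow : LinearIndependent ℝ T.row := by
    rw [linearIndependent_iff_card_eq_finrank_span, Set.finrank, ← rank_eq_finrank_span_row, hT,
      Fintype.card_fin]
  have hK : (T * (H * Hᵀ) * Tᵀ).PosDef := by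
    rw [← conjTranspose_eq_transpose_of_trivial T]
    exact hH.mul_mul_conjTranspose_same (vecMul_injective_iff.mpr hrow)
  obtain ⟨B, hB⟩ := CStarAlgebra.nonneg_iff_eq_star_mul_self.mp hK.posSemidef.nonneg
  rw [star_eq_conjTranspose, conjTranspose_eq_transpose_of_trivial] at hB
  have hBu : IsUnit (Bᵀ).det := by
    have := (isUnit_iff_isUnit_det _).mp hK.isUnit
    rw [hB, det_mul] at this
    exact isUnit_of_mul_isUnit_left this
  have hR := mul_nonsing_inv _ hBu
  have hRt : B * (Bᵀ)⁻¹ᵀ = 1 := by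
    rw [← transpose_transpose B, ← transpose_mul, transpose_transpose B, nonsing_inv_mul _ hBu,
      transpose_one]
  refine ⟨((Bᵀ)⁻¹ * (T * H))ᵀ, Bᵀ, (Bᵀ)⁻¹, ?_, hR, ?_⟩
  · rw [transpose_transpose, transpose_mul, transpose_mul]
    calc _ = (Bᵀ)⁻¹ * (T * (H * Hᵀ) * Tᵀ) * (Bᵀ)⁻¹ᵀ := by simp only [Matrix.mul_assoc]
      _ = ((Bᵀ)⁻¹ * Bᵀ) * (B * (Bᵀ)⁻¹ᵀ) := by rw [hB]; simp only [Matrix.mul_assoc]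
      _ = 1 := by rw [hRt, nonsing_inv_mul _ hBu, one_mul]
  · rw [transpose_transpose, ← Matrix.mul_assoc, hR, Matrix.one_mul]

/-- With `Σx = F Λ² Fᵀ`, `P := Λ⁻¹ Fᵀ (Σx + Σe) F Λ⁻¹ = Up Λp Upᵀ` and
`Λ̂p := I_n − Λp⁻¹`: if `M*` (with orthonormal columns) maximizes
`det(I_m + (Mᵀ Λ̂p M)⁻¹)` over all `M` with orthonormal columns, then for any orthogonal
`E` and diagonal positive-definite `D`, the matrix `T* := E D M*ᵀ Upᵀ Λ⁻¹ Fᵀ` has rank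
`m` and maximizes `det(I_m + (1/2) W(T))` over all full-rank `T`. -/
theorem optimal_T_from_optimal_M (m n : ℕ) (hm : 0 < m) (hmn : m < n)
    (Sx Se : Matrix (Fin n) (Fin n) ℝ) (hSx : Sx.PosDef) (hSe : Se.PosDef)
    (F : Matrix (Fin n) (Fin n) ℝ) (hF : Fᵀ * F = 1)
    (dL : Fin n → ℝ) (hdL : ∀ i, 0 < dL i)
    (hSxEig : Sx = F * (Matrix.diagonal dL) ^ 2 * Fᵀ)
    (Up : Matrix (Fin n) (Fin n) ℝ) (hUp : Upᵀ * Up = 1)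
    (dP : Fin n → ℝ)
    (hP : (Matrix.diagonal dL)⁻¹ * Fᵀ * (Sx + Se) * F * (Matrix.diagonal dL)⁻¹
        = Up * Matrix.diagonal dP * Upᵀ)
    (Mstar : Matrix (Fin n) (Fin m) ℝ) (hMstar : Mstarᵀ * Mstar = 1)
    (hopt : ∀ M : Matrix (Fin n) (Fin m) ℝ, Mᵀ * M = 1 →
      ((1 : Matrix (Fin m) (Fin m) ℝ) + (Mᵀ * (1 - (Matrix.diagonal dP)⁻¹) * M)⁻¹).det
        ≤ ((1 : Matrix (Fin m) (Fin m) ℝ)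
            + (Mstarᵀ * (1 - (Matrix.diagonal dP)⁻¹) * Mstar)⁻¹).det)
    (E : Matrix (Fin m) (Fin m) ℝ) (hE : Eᵀ * E = 1)
    (dD : Fin m → ℝ) (hdD : ∀ i, 0 < dD i)
    (Tstar : Matrix (Fin m) (Fin n) ℝ)
    (hTstar : Tstar
        = E * Matrix.diagonal dD * Mstarᵀ * Upᵀ * (Matrix.diagonal dL)⁻¹ * Fᵀ) :
    Tstar.rank = m ∧
      ∀ T : Matrix (Fin m) (Fin n) ℝ, T.rank = m →
        ((1 : Matrix (Fin m) (Fin m) ℝ) + (1 / 2 : ℝ) • Wmat Sx Se T).det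
          ≤ ((1 : Matrix (Fin m) (Fin m) ℝ) + (1 / 2 : ℝ) • Wmat Sx Se Tstar).det := by
  set L := Matrix.diagonal dL with hL
  have hLL : L * L⁻¹ = 1 := by
    refine mul_nonsing_inv _ ?_
    rw [hL, det_diagonal]
    exact (Finset.prod_pos fun i _ ↦ hdL i).ne'.isUnit
  have hLL' : L⁻¹ * L = 1 := mul_eq_one_comm.mp hLL
  have hLt : Lᵀ = L := diagonal_transpose dL
  have hF' : F * Fᵀ = 1 := mul_eq_one_comm.mp hF
  have hUp' : Up * Upᵀ = 1 := mul_eq_one_comm.mp hUp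
  have hH : (F * L * Up) * (Upᵀ * L⁻¹ * Fᵀ) = 1 := by
    calc _ = F * (L * (Up * Upᵀ) * L⁻¹) * Fᵀ := by simp only [mul_assoc]
      _ = 1 := by rw [hUp', mul_one, hLL, mul_one, hF']
  have hx : Sx = (F * L * Up) * (F * L * Up)ᵀ := by
    calc Sx = F * L * (Up * Upᵀ) * L * Fᵀ := by
          rw [hSxEig, hUp', mul_one, pow_two]; simp only [mul_assoc]
      _ = _ := by rw [transpose_mul, transpose_mul, hLt]; simp only [mul_assoc]
  have hxe : Sx + Se = (F * L * Up) * diagonal dP * (F * L * Up)ᵀ := by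
    calc Sx + Se = F * Fᵀ * (Sx + Se) * (F * Fᵀ) := by rw [hF', one_mul, mul_one]
      _ = F * (L * L⁻¹) * Fᵀ * (Sx + Se) * F * (L⁻¹ * L) * Fᵀ := by
          rw [hLL, hLL', mul_one, mul_one]; simp only [mul_assoc]
      _ = F * L * (L⁻¹ * Fᵀ * (Sx + Se) * F * L⁻¹) * L * Fᵀ := by simp only [mul_assoc]
      _ = _ := by
          rw [hP, transpose_mul, transpose_mul, hLt]; simp only [mul_assoc]
  have hDD : diagonal dD * diagonal (fun i ↦ (dD i)⁻¹) = 1 := by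
    rw [diagonal_mul_diagonal, ← diagonal_one]
    exact congrArg _ (funext fun i ↦ mul_inv_cancel₀ (hdD i).ne')
  have hR : (E * diagonal dD) * (diagonal (fun i ↦ (dD i)⁻¹) * Eᵀ) = 1 := by
    calc _ = E * (diagonal dD * diagonal (fun i ↦ (dD i)⁻¹)) * Eᵀ := by simp only [mul_assoc]
      _ = 1 := by rw [hDD, mul_one, mul_eq_one_comm.mp hE]
  have hT : Tstar * (F * L * Up) = (E * diagonal dD) * Mstarᵀ := by
    calc _ = (E * diagonal dD) * Mstarᵀ * ((Upᵀ * L⁻¹ * Fᵀ) * (F * L * Up)) := by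
          rw [hTstar]; simp only [Matrix.mul_assoc]
      _ = _ := by rw [mul_eq_one_comm.mp hH, Matrix.mul_one]
  refine ⟨le_antisymm (by simpa using Tstar.rank_le_height) ?_, fun T hTr ↦ ?_⟩
  · have h : Tstar * ((F * L * Up) * (Mstar * (diagonal (fun i ↦ (dD i)⁻¹) * Eᵀ))) = 1 := by
      calc _ = Tstar * (F * L * Up) * Mstar * (diagonal (fun i ↦ (dD i)⁻¹) * Eᵀ) := by
            simp only [Matrix.mul_assoc]
        _ = 1 := by rw [hT, Matrix.mul_assoc _ Mstarᵀ, hMstar, Matrix.mul_one, hR]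
    have := rank_mul_le_left Tstar
      ((F * L * Up) * (Mstar * (diagonal (fun i ↦ (dD i)⁻¹) * Eᵀ)))
    rwa [h, rank_one, Fintype.card_fin] at this
  · obtain ⟨M, R, R', hM, hRR, hTM⟩ := exists_mul_transpose_of_rank_eq (hx ▸ hSx) hTr
    rw [det_one_add_half_Wmat hSe hH hx hxe hM hRR hTM,
      det_one_add_half_Wmat hSe hH hx hxe hMstar hR hT]
    exact mul_le_mul_of_nonneg_left (hopt M hM) (by positivity)
end

section
/- Let Λ̂ be an n×n real symmetric positive definite matrix with eigenvalues λ_1 ≤ λ_2 ≤ … ≤ λ_n (in non-decreasing order). Then for every n×m real matrix M with MᵀM = I_m, the m×m matrix Mᵀ Λ̂ M is positive definite and det(I_m + (Mᵀ Λ̂ M)⁻¹) ≤ ∏_{i=1}^m (1 + 1/λ_i). -/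
open Matrix

/-- A real symmetric matrix is orthogonally diagonalizable with eigenvalues in non-decreasing
order. -/
theorem Matrix.IsHermitian.exists_monotone_diagonalization {m : ℕ}
    {B : Matrix (Fin m) (Fin m) ℝ} (hB : B.IsHermitian) :
    ∃ (V : Matrix (Fin m) (Fin m) ℝ) (mu : Fin m → ℝ),
      Monotone mu ∧ Vᵀ * V = 1 ∧ B = V * diagonal mu * Vᵀ := by
  have hunit : (hB.eigenvectorUnitary : Matrix (Fin m) (Fin m) ℝ)ᵀ * hB.eigenvectorUnitary = 1 :=
    Unitary.coe_star_mul_self hB.eigenvectorUnitary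
  have hspec : B = hB.eigenvectorUnitary * diagonal hB.eigenvalues *
      (hB.eigenvectorUnitary : Matrix (Fin m) (Fin m) ℝ)ᵀ := hB.spectral_theorem
  generalize (hB.eigenvectorUnitary : Matrix (Fin m) (Fin m) ℝ) = V at hunit hspec
  let σ := Tuple.sort hB.eigenvalues
  refine ⟨V.submatrix id σ, hB.eigenvalues ∘ σ, Tuple.monotone_sort _, ?_, ?_⟩
  · rw [transpose_submatrix, submatrix_mul _ _ _ _ _ Function.bijective_id |>.symm, hunit,
      submatrix_one_equiv]
  · rw [← submatrix_diagonal_equiv, transpose_submatrix, submatrix_mul_equiv,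
      submatrix_mul_equiv, submatrix_id_id]
    exact hspec

/-- The **Poincaré separation theorem** for a diagonal matrix: the eigenvalues of a compression
dominate the smallest eigenvalues of the original matrix. -/
theorem poincare_separation_diagonal {m n : ℕ} (hmn : m ≤ n)
    {lam : Fin n → ℝ} (hlam : Monotone lam) {mu : Fin m → ℝ} (hmu : Monotone mu)
    {W : Matrix (Fin n) (Fin m) ℝ} (hW : Wᵀ * W = 1)
    (hWmu : Wᵀ * diagonal lam * W = diagonal mu) (i : Fin m) :
    lam (Fin.castLE hmn i) ≤ mu i := by
  let A : Matrix (Fin m) (Fin m) ℝ := of fun j =>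
    if j < i then W (Fin.castLE hmn j) else if j = i then 0 else Pi.single j 1
  have hdet : A.det = 0 := det_eq_zero_of_row_eq_zero i fun k => by simp [A]
  obtain ⟨c, hc, hAc⟩ := exists_mulVec_eq_zero_iff.mpr hdet
  have hx : ∀ k : Fin n, k < Fin.castLE hmn i → (W *ᵥ c) k = 0 := by
    intro k hk
    have hki : k.val < i.val := hk
    have hrow : A ⟨k, hki.trans i.isLt⟩ = W k := if_pos hki
    have := congrFun hAc ⟨k, hki.trans i.isLt⟩
    rwa [mulVec, hrow] at this
  have hc' : ∀ j, i < j → c j = 0 := by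
    intro j hj
    have := congrFun hAc j
    simpa [A, mulVec, hj.not_gt, hj.ne'] using this
  have hnorm : ∑ k, (W *ᵥ c) k ^ 2 = ∑ j, c j ^ 2 := by
    have : (W *ᵥ c) ⬝ᵥ (W *ᵥ c) = c ⬝ᵥ c := by
      rw [dotProduct_mulVec, ← mulVec_transpose, mulVec_mulVec, hW, one_mulVec]
    simpa [dotProduct, sq] using this
  have hquad : ∑ k, lam k * (W *ᵥ c) k ^ 2 = ∑ j, mu j * c j ^ 2 := by
    have : (W *ᵥ c) ⬝ᵥ (diagonal lam *ᵥ (W *ᵥ c)) = c ⬝ᵥ (diagonal mu *ᵥ c) := by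
      rw [← hWmu, dotProduct_comm, dotProduct_mulVec, ← mulVec_transpose, dotProduct_comm,
        mulVec_mulVec, mulVec_mulVec, Matrix.mul_assoc]
    simp only [dotProduct, mulVec_diagonal] at this
    convert this using 2 <;> ring
  have hpos : 0 < ∑ j, c j ^ 2 := by
    obtain ⟨j, hj⟩ := Function.ne_iff.mp hc
    exact Finset.sum_pos' (fun _ _ => sq_nonneg _) ⟨j, Finset.mem_univ j, sq_pos_of_ne_zero hj⟩
  refine le_of_mul_le_mul_right ?_ hpos
  calc lam (Fin.castLE hmn i) * ∑ j, c j ^ 2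
      = ∑ k, lam (Fin.castLE hmn i) * (W *ᵥ c) k ^ 2 := by rw [← hnorm, Finset.mul_sum]
    _ ≤ ∑ k, lam k * (W *ᵥ c) k ^ 2 := by
        refine Finset.sum_le_sum fun k _ => ?_
        rcases lt_or_ge k (Fin.castLE hmn i) with hk | hk
        · simp [hx k hk]
        · exact mul_le_mul_of_nonneg_right (hlam hk) (sq_nonneg _)
    _ = ∑ j, mu j * c j ^ 2 := hquad
    _ ≤ ∑ j, mu i * c j ^ 2 := by
        refine Finset.sum_le_sum fun j _ => ?_
        rcases lt_or_ge i j with hj | hj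
        · simp [hc' j hj]
        · exact mul_le_mul_of_nonneg_right (hmu hj) (sq_nonneg _)
    _ = mu i * ∑ j, c j ^ 2 := by rw [Finset.mul_sum]

/-- The determinant of `1 + B⁻¹` in terms of an orthogonal diagonalization of `B`. -/
theorem det_one_add_inv_of_diagonalization {m : ℕ} {V : Matrix (Fin m) (Fin m) ℝ}
    {mu : Fin m → ℝ} (hV : Vᵀ * V = 1) (hmu : ∀ i, mu i ≠ 0) :
    (1 + (V * diagonal mu * Vᵀ)⁻¹).det = ∏ i, (1 + 1 / mu i) := by
  have hV' : V * Vᵀ = 1 := mul_eq_one_comm.mp hV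
  have hinv : (V * diagonal mu * Vᵀ)⁻¹ = V * diagonal mu⁻¹ * Vᵀ := by
    refine inv_eq_right_inv ?_
    have hd : diagonal mu * diagonal mu⁻¹ = 1 := by
      rw [diagonal_mul_diagonal, ← diagonal_one]
      congr 1
      ext i
      exact mul_inv_cancel₀ (hmu i)
    calc V * diagonal mu * Vᵀ * (V * diagonal mu⁻¹ * Vᵀ)
        = V * (diagonal mu * (Vᵀ * V) * diagonal mu⁻¹) * Vᵀ := by simp only [Matrix.mul_assoc]
      _ = 1 := by rw [hV, Matrix.mul_one, hd, Matrix.mul_one, hV']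
  have hsum : 1 + V * diagonal mu⁻¹ * Vᵀ = V * diagonal (fun i => 1 + 1 / mu i) * Vᵀ := by
    have : diagonal (fun i => 1 + 1 / mu i) = 1 + diagonal mu⁻¹ := by
      rw [← diagonal_one, diagonal_add]
      simp
    rw [this, Matrix.mul_add, Matrix.add_mul, Matrix.mul_one, hV']
  rw [hinv, hsum, det_mul_right_comm, hV', Matrix.one_mul, det_diagonal]

/-- Let `Λ̂` be an `n×n` real symmetric positive definite matrix with eigenvalues
`λ_1 ≤ … ≤ λ_n` in non-decreasing order (i.e. `Λ̂ = U (diagonal λ) Uᵀ` for some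
orthogonal `U` and a monotone `λ`).  Then for every `n×m` real matrix `M` with
orthonormal columns, `Mᵀ Λ̂ M` is positive definite and
`det(I_m + (Mᵀ Λ̂ M)⁻¹) ≤ ∏_{i=1}^m (1 + 1/λ_i)`. -/
theorem det_bound_poincare (m n : ℕ) (hm : 0 < m) (hmn : m ≤ n)
    (L : Matrix (Fin n) (Fin n) ℝ) (hL : L.PosDef)
    (lam : Fin n → ℝ) (hlam : Monotone lam)
    (U : Matrix (Fin n) (Fin n) ℝ) (hU : Uᵀ * U = 1)
    (hLeig : L = U * Matrix.diagonal lam * Uᵀ)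
    (M : Matrix (Fin n) (Fin m) ℝ) (hM : Mᵀ * M = 1) :
    (Mᵀ * L * M).PosDef ∧
      ((1 : Matrix (Fin m) (Fin m) ℝ) + (Mᵀ * L * M)⁻¹).det
        ≤ ∏ i : Fin m, (1 + 1 / lam (Fin.castLE hmn i)) := by
  have hpd : (Mᵀ * L * M).PosDef := by
    have hinj : Function.Injective M.mulVec := by
      intro x y hxy
      simpa [mulVec_mulVec, hM] using congrArg (Mᵀ *ᵥ ·) hxy
    simpa using hL.conjTranspose_mul_mul_same hinj
  refine ⟨hpd, ?_⟩
  obtain ⟨V, mu, hmu, hV, hB⟩ := hpd.isHermitian.exists_monotone_diagonalization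
  have hU' : U * Uᵀ = 1 := mul_eq_one_comm.mp hU
  have hW : (Uᵀ * M * V)ᵀ * (Uᵀ * M * V) = 1 := by
    calc (Uᵀ * M * V)ᵀ * (Uᵀ * M * V) = Vᵀ * (Mᵀ * (U * Uᵀ) * M) * V := by
          simp only [transpose_mul, transpose_transpose, Matrix.mul_assoc]
      _ = 1 := by rw [hU', Matrix.mul_one, hM, Matrix.mul_one, hV]
  have hWmu : (Uᵀ * M * V)ᵀ * diagonal lam * (Uᵀ * M * V) = diagonal mu := by
    calc (Uᵀ * M * V)ᵀ * diagonal lam * (Uᵀ * M * V)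
        = Vᵀ * (Mᵀ * (U * diagonal lam * Uᵀ) * M) * V := by
          simp only [transpose_mul, transpose_transpose, Matrix.mul_assoc]
      _ = (Vᵀ * V) * diagonal mu * (Vᵀ * V) := by
          rw [← hLeig, hB]
          simp only [Matrix.mul_assoc]
      _ = diagonal mu := by rw [hV, Matrix.one_mul, Matrix.mul_one]
  have hle := poincare_separation_diagonal hmn hlam hmu hW hWmu
  have hlam_pos : ∀ k, 0 < lam k := by
    have hUunit : IsUnit U := IsUnit.of_mul_eq_one Uᵀ hU'
    refine posDef_diagonal_iff.mp ?_
    refine (hUunit.posDef_star_right_conjugate_iff).mp ?_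
    rw [hLeig] at hL
    exact hL
  rw [hB, det_one_add_inv_of_diagonalization hV fun i => ((hlam_pos _).trans_le (hle i)).ne']
  refine Finset.prod_le_prod (fun i _ => ?_) fun i _ => ?_
  · have := (hlam_pos _).trans_le (hle i)
    positivity
  · gcongr
    · exact hlam_pos _
    · exact hle i
end

section
/- Let Λ̂ be an n×n real diagonal matrix with positive diagonal entries d_1 ≤ d_2 ≤ … ≤ d_n arranged in non-decreasing order, let Γ be an m×m real orthogonal matrix, and let M be the n×m matrix whose top m×m block is Γ and whose bottom (n−m)×m block is zero. Then MᵀM = I_m and det(I_m + (Mᵀ Λ̂ M)⁻¹) = ∏_{i=1}^m (1 + 1/d_i); in particular the upper bound ∏_{i=1}^m (1 + 1/d_i) over all matrices with orthonormal columns is attained. -/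
open Matrix

/-- Stacking `G` on top of a zero block is multiplication by the coordinate inclusion. -/
theorem of_dite_eq_submatrix_one_mul {m n : ℕ} (hmn : m ≤ n) (G : Matrix (Fin m) (Fin m) ℝ) :
    (Matrix.of fun (i : Fin n) (j : Fin m) => if h : (i : ℕ) < m then G ⟨(i : ℕ), h⟩ j else 0)
      = (1 : Matrix (Fin n) (Fin n) ℝ).submatrix id (Fin.castLE hmn) * G := by
  ext i j
  simp only [of_apply, mul_apply, submatrix_apply, id, one_apply, ite_mul, one_mul, zero_mul]
  split_ifs with h
  · rw [Finset.sum_eq_single ⟨i, h⟩]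
    · simp
    · intro k _ hk
      exact if_neg fun hik => hk (by simp [hik])
    · simp
  · refine (Finset.sum_eq_zero fun k _ => if_neg ?_).symm
    rintro rfl
    exact h k.isLt

/-- Compressing a diagonal matrix by an injective coordinate inclusion selects its entries. -/
theorem transpose_submatrix_one_mul_diagonal_mul {ι κ : Type*} [Fintype ι] [DecidableEq ι]
    [Fintype κ] [DecidableEq κ] (e : κ → ι) (he : Function.Injective e) (d : ι → ℝ) :
    ((1 : Matrix ι ι ℝ).submatrix id e)ᵀ * diagonal d * (1 : Matrix ι ι ℝ).submatrix id e
      = diagonal (d ∘ e) := by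
  ext i j
  by_cases h : i = j <;> simp [mul_apply, diagonal_apply, one_apply, he.eq_iff, h]

/-- The determinant of `1 + A⁻¹` for `A` orthogonally similar to an invertible diagonal matrix. -/
theorem det_one_add_inv_transpose_mul_diagonal_mul {κ : Type*} [Fintype κ] [DecidableEq κ]
    (d : κ → ℝ) (hd : ∀ i, d i ≠ 0) (G : Matrix κ κ ℝ) (hG : Gᵀ * G = 1) :
    (1 + (Gᵀ * diagonal d * G)⁻¹).det = ∏ i, (1 + 1 / d i) := by
  have hG' : G * Gᵀ = 1 := mul_eq_one_comm.mp hG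
  have hdiag : diagonal d * diagonal (fun i => 1 / d i) = 1 := by
    simp [diagonal_mul_diagonal, hd]
  have hinv : (Gᵀ * diagonal d * G)⁻¹ = Gᵀ * diagonal (fun i => 1 / d i) * G := by
    refine inv_eq_right_inv ?_
    calc Gᵀ * diagonal d * G * (Gᵀ * diagonal (fun i => 1 / d i) * G)
        = Gᵀ * (diagonal d * ((G * Gᵀ) * diagonal (fun i => 1 / d i))) * G := by
          simp only [Matrix.mul_assoc]
      _ = 1 := by rw [hG', Matrix.one_mul, hdiag, Matrix.mul_one, hG]
  have hsum : 1 + (Gᵀ * diagonal d * G)⁻¹ = Gᵀ * diagonal (fun i => 1 + 1 / d i) * G := by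
    rw [hinv, ← diagonal_add, diagonal_one, Matrix.mul_add, Matrix.add_mul, Matrix.mul_one, hG]
  have hdet : Gᵀ.det * G.det = 1 := by rw [← det_mul, hG, det_one]
  rw [hsum, det_mul, det_mul, det_diagonal, mul_right_comm, hdet, one_mul]

/-- Let `Λ̂ = diagonal d` with positive entries `d_1 ≤ … ≤ d_n` in non-decreasing order,
let `Γ` be an `m×m` orthogonal matrix, and let `M` be the `n×m` matrix whose top `m×m`
block is `Γ` and whose bottom `(n−m)×m` block is zero.  Then `Mᵀ M = I_m` and
`det(I_m + (Mᵀ Λ̂ M)⁻¹) = ∏_{i=1}^m (1 + 1/d_i)`; in particular the upper bound over all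
matrices with orthonormal columns is attained. -/
theorem det_bound_attained (m n : ℕ) (hm : 0 < m) (hmn : m ≤ n)
    (d : Fin n → ℝ) (hd : ∀ i, 0 < d i) (hmono : Monotone d)
    (G : Matrix (Fin m) (Fin m) ℝ) (hG : Gᵀ * G = 1)
    (M : Matrix (Fin n) (Fin m) ℝ)
    (hMdef : M = Matrix.of fun (i : Fin n) (j : Fin m) =>
      if h : (i : ℕ) < m then G ⟨(i : ℕ), h⟩ j else 0) :
    Mᵀ * M = 1 ∧
      ((1 : Matrix (Fin m) (Fin m) ℝ) + (Mᵀ * Matrix.diagonal d * M)⁻¹).det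
        = ∏ i : Fin m, (1 + 1 / d (Fin.castLE hmn i)) := by
  have hinj : Function.Injective (Fin.castLE hmn) := Fin.castLE_injective hmn
  have hcompress : ∀ c : Fin n → ℝ,
      Mᵀ * diagonal c * M = Gᵀ * diagonal (c ∘ Fin.castLE hmn) * G := fun c => by
    rw [hMdef, of_dite_eq_submatrix_one_mul hmn,
      ← transpose_submatrix_one_mul_diagonal_mul _ hinj c, transpose_mul]
    simp only [Matrix.mul_assoc]
  constructor
  · have h := hcompress 1
    rwa [Pi.one_comp, diagonal_one', diagonal_one', Matrix.mul_one, Matrix.mul_one, hG] at h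
  · rw [hcompress]
    exact det_one_add_inv_transpose_mul_diagonal_mul _ (fun i => (hd _).ne') G hG
end

section
/- Let Q be an n×n permutation matrix such that the diagonal entries of Q Λ̂p Qᵀ are in non-decreasing order, let Γ be an m×m real orthogonal matrix, and let M := Qᵀ · [Γ; 0_{(n−m)×m}] (the n×m matrix whose top block is Γ and bottom block is zero, premultiplied by Qᵀ). Let E be an arbitrary m×m real orthogonal matrix and D an arbitrary m×m diagonal matrix with positive diagonal entries, and set T := E D Mᵀ Upᵀ Λ⁻¹ Fᵀ. Then rank T = m, and for every m×n real matrix T' with rank T' = m, det(I_m + (1/2)·W(T')) ≤ det(I_m + (1/2)·W(T)) = 2^{-m} · ∏_{i=1}^m (1 + 1/d_i), where d_1 ≤ … ≤ d_m are the m smallest diagonal entries of Λ̂p. -/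
open Matrix

/-- A symmetrized Cauchy–Binet formula, summing over all maps instead of over subsets. -/
theorem Matrix.factorial_smul_det_mul {ι κ R : Type*} [CommRing R] [Fintype ι] [DecidableEq ι]
    [Fintype κ] (A : Matrix ι κ R) (B : Matrix κ ι R) :
    (Fintype.card ι).factorial • (A * B).det
      = ∑ f : ι → κ, (A.submatrix id f).det * (B.submatrix f id).det := by
  classical
  have expand : (A * B).det = ∑ f : ι → κ, (∏ i, A i (f i)) * (B.submatrix f id).det := by
    have h : A * B = fun i => ∑ k, A i k • B k := by
      ext i j
      simp [Matrix.mul_apply]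
    have := (detRowAlternating (n := ι) (R := R)).toMultilinearMap.map_sum
      (fun i k => A i k • B k)
    simp only [MultilinearMap.map_smul_univ] at this
    rw [h]
    exact this
  have perm (τ : Equiv.Perm ι) : (A * B).det = ∑ f : ι → κ,
      (Equiv.Perm.sign τ : R) * (∏ i, A i (f (τ i))) * (B.submatrix f id).det := by
    rw [expand]
    refine (Fintype.sum_equiv (τ.symm.arrowCongr (Equiv.refl κ)) _ _ fun f => ?_).symm
    have : (B.submatrix (f ∘ τ) id).det = Equiv.Perm.sign τ * (B.submatrix f id).det :=
      det_permute τ (B.submatrix f id)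
    change _ = (∏ i, A i (f (τ i))) * (B.submatrix (f ∘ τ) id).det
    rw [this]
    ring
  rw [← Fintype.card_perm, ← Finset.card_univ, ← Finset.sum_const,
    Finset.sum_congr rfl fun τ _ => perm τ, Finset.sum_comm]
  refine Finset.sum_congr rfl fun f _ => ?_
  rw [← det_transpose (A.submatrix id f), det_apply' (A.submatrix id f)ᵀ, Finset.sum_mul]
  rfl

/-- Among injective selections of `m` values of an antitone sequence, the first `m` have the
largest product. -/
theorem prod_comp_le_prod_castLE {m n : ℕ} (hmn : m ≤ n) {g : Fin n → ℝ} (hg : Antitone g)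
    (hpos : ∀ i, 0 ≤ g i) {f : Fin m → Fin n} (hf : Function.Injective f) :
    ∏ i, g (f i) ≤ ∏ i, g (Fin.castLE hmn i) := by
  classical
  set s : Finset (Fin n) := Finset.univ.image f
  have hs : s.card = m := by simp [s, Finset.card_image_of_injective _ hf]
  have hle (k : Fin m) : Fin.castLE hmn k ≤ s.orderEmbOfFin hs k := by
    obtain ⟨k, hk⟩ := k
    induction k with
    | zero => exact Nat.zero_le _
    | succ k ih =>
      have h1 := ih (k.lt_succ_self.trans hk)
      have h2 : s.orderEmbOfFin hs ⟨k, k.lt_succ_self.trans hk⟩ < s.orderEmbOfFin hs ⟨k + 1, hk⟩ :=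
        (s.orderEmbOfFin hs).strictMono (Fin.mk_lt_mk.2 k.lt_succ_self)
      exact Nat.succ_le_of_lt (lt_of_le_of_lt h1 h2)
  calc ∏ i, g (f i) = ∏ x ∈ s, g x := (Finset.prod_image fun _ _ _ _ h => hf h).symm
    _ = ∏ i, g (s.orderEmbOfFin hs i) := by
      rw [← Finset.prod_image (f := g) fun _ _ _ _ h => (s.orderEmbOfFin hs).injective h,
        Finset.image_orderEmbOfFin_univ]
    _ ≤ _ := Finset.prod_le_prod (fun _ _ => hpos _) fun i _ => hg (hle i)

theorem Matrix.factorial_smul_det_mul_diagonal_mul_transpose {m n : ℕ}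
    (A : Matrix (Fin m) (Fin n) ℝ) (d : Fin n → ℝ) :
    m.factorial • (A * diagonal d * Aᵀ).det
      = ∑ f : Fin m → Fin n, (A.submatrix id f).det ^ 2 * ∏ i, d (f i) := by
  have h := factorial_smul_det_mul (A * diagonal d) Aᵀ
  rw [Fintype.card_fin] at h
  rw [h]
  refine Finset.sum_congr rfl fun f _ => ?_
  have h1 : (A * diagonal d).submatrix id f = A.submatrix id f * diagonal (d ∘ f) := by
    ext i j
    simp
  have h2 : Aᵀ.submatrix f id = (A.submatrix id f)ᵀ := rfl
  rw [h1, h2, det_mul, det_diagonal, det_transpose]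
  simp only [Function.comp_apply]
  ring

theorem Matrix.det_mul_diagonal_one_add_le {m n : ℕ} (hmn : m ≤ n) {d : Fin n → ℝ}
    (hd : Monotone d) (hpos : ∀ i, 0 < d i) (A : Matrix (Fin m) (Fin n) ℝ) :
    (A * diagonal (fun i => 1 + d i) * Aᵀ).det
      ≤ (∏ i : Fin m, (1 + 1 / d (Fin.castLE hmn i))) * (A * diagonal d * Aᵀ).det := by
  have hfac : (0 : ℝ) < m.factorial := by exact_mod_cast m.factorial_pos
  refine le_of_mul_le_mul_left ?_ hfac
  rw [mul_left_comm, ← nsmul_eq_mul, ← nsmul_eq_mul,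
    factorial_smul_det_mul_diagonal_mul_transpose, factorial_smul_det_mul_diagonal_mul_transpose,
    Finset.mul_sum]
  refine Finset.sum_le_sum fun f _ => ?_
  by_cases hf : Function.Injective f
  · have hprod : ∏ i, (1 + d (f i)) = (∏ i, (1 + 1 / d (f i))) * ∏ i, d (f i) := by
      rw [← Finset.prod_mul_distrib]
      refine Finset.prod_congr rfl fun i _ => ?_
      rw [add_mul, one_mul, one_div_mul_cancel (hpos _).ne', add_comm]
    have hle : ∏ i, (1 + 1 / d (f i)) ≤ ∏ i, (1 + 1 / d (Fin.castLE hmn i)) :=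
      prod_comp_le_prod_castLE hmn (g := fun i => 1 + 1 / d i)
        (fun i j hij => add_le_add_right (one_div_le_one_div_of_le (hpos i) (hd hij)) 1)
        (fun i => by have := hpos i; positivity) hf
    have hd0 : 0 ≤ ∏ i, d (f i) := Finset.prod_nonneg fun i _ => (hpos _).le
    rw [hprod, mul_left_comm]
    exact mul_le_mul_of_nonneg_right hle (mul_nonneg (sq_nonneg _) hd0)
  · obtain ⟨i, j, hij, hne⟩ : ∃ i j, f i = f j ∧ i ≠ j := by
      simpa [Function.Injective] using hf
    rw [det_zero_of_column_eq hne fun k => by simp [hij]]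
    simp

theorem Matrix.vecMul_injective_of_rank_eq {m n : ℕ} {S : Matrix (Fin m) (Fin n) ℝ}
    (hS : S.rank = m) : Function.Injective S.vecMul := by
  rw [vecMul_injective_iff, linearIndependent_iff_card_eq_finrank_span, Fintype.card_fin,
    Set.finrank, ← rank_eq_finrank_span_row, hS]

section Wmat

variable {m n : ℕ} {Sx Se : Matrix (Fin n) (Fin n) ℝ} {S : Matrix (Fin m) (Fin n) ℝ}

theorem Wmat_mul (hSx : Sx.PosDef) (hSe : Se.PosDef) (hS : S.rank = m) :
    Wmat Sx Se S * (S * Sx * Sᵀ - S * Sx * (Sx + Se)⁻¹ * Sx * Sᵀ)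
      = S * Sx * (Sx + Se)⁻¹ * Sx * Sᵀ := by
  set R := S * Sx * Sᵀ with hR
  set P := Sx + Se with hP
  have hRpd : R.PosDef := by
    simpa [hR] using hSx.mul_mul_conjTranspose_same (vecMul_injective_of_rank_eq hS)
  have hR1 : R⁻¹ * R = 1 := nonsing_inv_mul _ ((isUnit_iff_isUnit_det _).1 hRpd.isUnit)
  have hP1 : P * P⁻¹ = 1 :=
    mul_nonsing_inv _ ((isUnit_iff_isUnit_det _).1 (hSx.add hSe).isUnit)
  have hSxT : Sxᵀ = Sx := by simpa using hSx.isHermitian.eq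
  have hRT : R⁻¹ᵀ = R⁻¹ := by simpa using hRpd.inv.isHermitian.eq
  have hschur : Sx - Sx * Sᵀ * R⁻¹ * S * Sx
      = (1 - Sᵀ * R⁻¹ * S * Sx)ᵀ * Sx * (1 - Sᵀ * R⁻¹ * S * Sx) := by
    have hcancel : Sx * Sᵀ * R⁻¹ * (S * Sx * Sᵀ) * R⁻¹ * S * Sx = Sx * Sᵀ * R⁻¹ * S * Sx := by
      rw [← hR, Matrix.mul_assoc (Sx * Sᵀ), hR1, Matrix.mul_one]
    simp only [transpose_sub, transpose_mul, transpose_one, transpose_transpose, hSxT, hRT,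
      Matrix.sub_mul, Matrix.mul_sub, Matrix.one_mul, Matrix.mul_one]
    simp only [Matrix.mul_assoc] at hcancel ⊢
    rw [hcancel]
    abel
  have hN : (P - Sx * Sᵀ * R⁻¹ * S * Sx).PosDef := by
    have : P - Sx * Sᵀ * R⁻¹ * S * Sx = Se + (Sx - Sx * Sᵀ * R⁻¹ * S * Sx) := by
      rw [hP]
      abel
    rw [this, hschur]
    exact hSe.add_posSemidef (hSx.posSemidef.conjTranspose_mul_mul_same _)
  set X := (P - Sx * Sᵀ * R⁻¹ * S * Sx)⁻¹
  have hXN : X * (P - Sx * Sᵀ * R⁻¹ * S * Sx) = 1 :=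
    nonsing_inv_mul _ ((isUnit_iff_isUnit_det _).1 hN.isUnit)
  have hXP : X - X * Sx * Sᵀ * R⁻¹ * S * Sx * P⁻¹ = P⁻¹ := by
    have := congrArg (· * P⁻¹) hXN
    simp only [Matrix.mul_sub, Matrix.sub_mul, Matrix.one_mul] at this
    rw [Matrix.mul_assoc X P, hP1, Matrix.mul_one] at this
    simpa only [Matrix.mul_assoc] using this
  have hW : Wmat Sx Se S = S * Sx * X * Sx * Sᵀ * R⁻¹ := rfl
  rw [hW, Matrix.mul_sub, Matrix.mul_assoc _ R⁻¹ R, hR1, Matrix.mul_one]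
  nth_rewrite 2 [← hXP]
  simp only [Matrix.mul_sub, Matrix.sub_mul, Matrix.mul_assoc]

variable {K : Matrix (Fin n) (Fin n) ℝ} {p : Fin n → ℝ}

theorem det_one_add_half_Wmat_s8 (hSx : Sx.PosDef) (hSe : Se.PosDef) (hS : S.rank = m)
    (hK : IsUnit K.det) (hp : ∀ i, 1 < p i) (hSxK : Sx = K * Kᵀ)
    (hPK : Sx + Se = K * diagonal p * Kᵀ) :
    0 < (S * K * diagonal (fun i => 1 - (p i)⁻¹) * (S * K)ᵀ).det ∧
    ((1 : Matrix (Fin m) (Fin m) ℝ) + (1 / 2 : ℝ) • Wmat Sx Se S).det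
        * (S * K * diagonal (fun i => 1 - (p i)⁻¹) * (S * K)ᵀ).det
      = ((2 : ℝ) ^ m)⁻¹ * (S * K * diagonal (fun i => 1 + (1 - (p i)⁻¹)) * (S * K)ᵀ).det := by
  have hp0 (i) : p i ≠ 0 := (zero_lt_one.trans (hp i)).ne'
  have hdiag : diagonal p * diagonal (fun i => (p i)⁻¹) = 1 := by
    simp [diagonal_mul_diagonal, hp0]
  have hKT : IsUnit Kᵀ.det := by rwa [det_transpose]
  have hR : S * Sx * Sᵀ = S * K * (S * K)ᵀ := by
    rw [hSxK, transpose_mul]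
    simp only [Matrix.mul_assoc]
  have hinv : (Sx + Se)⁻¹ = Kᵀ⁻¹ * diagonal (fun i => (p i)⁻¹) * K⁻¹ := by
    rw [hPK, Matrix.mul_inv_rev, Matrix.mul_inv_rev, inv_eq_right_inv hdiag, Matrix.mul_assoc]
  have hKp : S * Sx * (Sx + Se)⁻¹ * Sx * Sᵀ
      = S * K * diagonal (fun i => (p i)⁻¹) * (S * K)ᵀ := by
    rw [hinv, hSxK, transpose_mul]
    simp only [Matrix.mul_assoc]
    rw [nonsing_inv_mul_cancel_left _ _ hK, mul_nonsing_inv_cancel_left _ _ hKT]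
  have hδ : S * Sx * Sᵀ - S * Sx * (Sx + Se)⁻¹ * Sx * Sᵀ
      = S * K * diagonal (fun i => 1 - (p i)⁻¹) * (S * K)ᵀ := by
    rw [hR, hKp, ← diagonal_sub, diagonal_one, Matrix.mul_sub, Matrix.sub_mul, Matrix.mul_one]
  have hδ' : S * Sx * Sᵀ - S * Sx * (Sx + Se)⁻¹ * Sx * Sᵀ
        + (1 / 2 : ℝ) • (S * Sx * (Sx + Se)⁻¹ * Sx * Sᵀ)
      = (1 / 2 : ℝ) • (S * K * diagonal (fun i => 1 + (1 - (p i)⁻¹)) * (S * K)ᵀ) := by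
    rw [← diagonal_add, ← diagonal_sub, diagonal_one, hR, hKp]
    simp only [Matrix.mul_add, Matrix.mul_sub, Matrix.add_mul, Matrix.sub_mul, Matrix.mul_one]
    module
  constructor
  · have hrank : (S * K).rank = m := by rw [rank_mul_eq_left_of_isUnit_det _ _ hK, hS]
    have := (PosDef.diagonal (d := fun i => 1 - (p i)⁻¹) fun i =>
      sub_pos.2 (inv_lt_one_of_one_lt₀ (hp i))).mul_mul_conjTranspose_same
        (vecMul_injective_of_rank_eq hrank)
    simpa using this.det_pos
  · rw [← hδ, ← det_mul, Matrix.add_mul, Matrix.one_mul, Matrix.smul_mul, Wmat_mul hSx hSe hS, hδ',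
      det_smul, Fintype.card_fin, one_div, inv_pow]

end Wmat

/-- With `Σx = F Λ² Fᵀ`, `P := Λ⁻¹ Fᵀ (Σx + Σe) F Λ⁻¹ = Up Λp Upᵀ` and
`Λ̂p := I_n − Λp⁻¹`: let `Q` be a permutation matrix such that the diagonal entries of
`Q Λ̂p Qᵀ` are in non-decreasing order, `Γ` an `m×m` orthogonal matrix,
`M := Qᵀ [Γ; 0]`, `E` orthogonal, `D` diagonal positive, and
`T := E D Mᵀ Upᵀ Λ⁻¹ Fᵀ`.  Then `rank T = m`, `T` maximizes `det(I_m + (1/2) W(·))` over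
all rank-`m` matrices, and `det(I_m + (1/2) W(T)) = 2^{-m} ∏_{i=1}^m (1 + 1/d_i)`,
where `d_1 ≤ … ≤ d_m` are the `m` smallest diagonal entries of `Λ̂p`. -/
theorem optimal_transform_construction (m n : ℕ) (hm : 0 < m) (hmn : m < n)
    (Sx Se : Matrix (Fin n) (Fin n) ℝ) (hSx : Sx.PosDef) (hSe : Se.PosDef)
    (F : Matrix (Fin n) (Fin n) ℝ) (hF : Fᵀ * F = 1)
    (dL : Fin n → ℝ) (hdL : ∀ i, 0 < dL i)
    (hSxEig : Sx = F * (Matrix.diagonal dL) ^ 2 * Fᵀ)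
    (Up : Matrix (Fin n) (Fin n) ℝ) (hUp : Upᵀ * Up = 1)
    (dP : Fin n → ℝ)
    (hP : (Matrix.diagonal dL)⁻¹ * Fᵀ * (Sx + Se) * F * (Matrix.diagonal dL)⁻¹
        = Up * Matrix.diagonal dP * Upᵀ)
    (σ : Equiv.Perm (Fin n)) (Q : Matrix (Fin n) (Fin n) ℝ)
    (hQ : Q = σ.permMatrix ℝ)
    (hsorted : Monotone fun i =>
      (Q * (1 - (Matrix.diagonal dP)⁻¹) * Qᵀ) i i)
    (G : Matrix (Fin m) (Fin m) ℝ) (hG : Gᵀ * G = 1)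
    (M : Matrix (Fin n) (Fin m) ℝ)
    (hMdef : M = Qᵀ * Matrix.of fun (i : Fin n) (j : Fin m) =>
      if h : (i : ℕ) < m then G ⟨(i : ℕ), h⟩ j else 0)
    (E : Matrix (Fin m) (Fin m) ℝ) (hE : Eᵀ * E = 1)
    (dD : Fin m → ℝ) (hdD : ∀ i, 0 < dD i)
    (T : Matrix (Fin m) (Fin n) ℝ)
    (hT : T = E * Matrix.diagonal dD * Mᵀ * Upᵀ * (Matrix.diagonal dL)⁻¹ * Fᵀ) :
    T.rank = m ∧
      (∀ T' : Matrix (Fin m) (Fin n) ℝ, T'.rank = m →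
        ((1 : Matrix (Fin m) (Fin m) ℝ) + (1 / 2 : ℝ) • Wmat Sx Se T').det
          ≤ ((1 : Matrix (Fin m) (Fin m) ℝ) + (1 / 2 : ℝ) • Wmat Sx Se T).det) ∧
      ((1 : Matrix (Fin m) (Fin m) ℝ) + (1 / 2 : ℝ) • Wmat Sx Se T).det
        = ((2 : ℝ) ^ m)⁻¹ * ∏ i : Fin m,
            (1 + 1 / ((Q * (1 - (Matrix.diagonal dP)⁻¹) * Qᵀ)
              (Fin.castLE hmn.le i) (Fin.castLE hmn.le i))) := by
  set L := diagonal dL with hL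
  have hLdet : IsUnit L.det := by
    rw [hL, det_diagonal, isUnit_iff_ne_zero]
    exact (Finset.prod_pos fun i _ => hdL i).ne'
  have hLT : Lᵀ = L := diagonal_transpose _
  have hFdet : IsUnit F.det := (isUnit_iff_isUnit_det _).1 (.of_mul_eq_one_right _ hF)
  have hUdet : IsUnit Up.det := (isUnit_iff_isUnit_det _).1 (.of_mul_eq_one_right _ hUp)
  have hFF : F * Fᵀ = 1 := mul_eq_one_comm.1 hF
  have hUU : Up * Upᵀ = 1 := mul_eq_one_comm.1 hUp
  have hQconj (d : Fin n → ℝ) : Q * diagonal d * Qᵀ = diagonal (d ∘ σ) := by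
    rw [hQ]
    ext i j
    simp [Equiv.Perm.permMatrix, PEquiv.toMatrix_toPEquiv_mul, mul_apply, diagonal_apply,
      PEquiv.toMatrix_apply, Equiv.eq_symm_apply, eq_comm]
  have hQQ : Q * Qᵀ = 1 := by simpa using hQconj 1
  have hQ' : Qᵀ * Q = 1 := mul_eq_one_comm.1 hQQ
  have hQdet : IsUnit Qᵀ.det := (isUnit_iff_isUnit_det _).1 (.of_mul_eq_one_right _ hQQ)
  set K := F * L * Up * Qᵀ with hKdef
  have hK : IsUnit K.det := by
    rw [hKdef, det_mul, det_mul, det_mul]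
    exact ((hFdet.mul hLdet).mul hUdet).mul hQdet
  have hKT : Kᵀ = Q * (Upᵀ * (L * Fᵀ)) := by
    simp [hKdef, hLT, Matrix.mul_assoc]
  have hSxK : Sx = K * Kᵀ := by
    rw [hSxEig, hKT, hKdef]
    simp only [Matrix.mul_assoc, pow_two]
    rw [← Matrix.mul_assoc Qᵀ Q, hQ', Matrix.one_mul, ← Matrix.mul_assoc Up, hUU, Matrix.one_mul]
  set p := dP ∘ σ with hp
  have hPK : Sx + Se = K * diagonal p * Kᵀ := by
    calc Sx + Se = F * L * (L⁻¹ * Fᵀ * (Sx + Se) * F * L⁻¹) * (L * Fᵀ) := by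
          simp only [Matrix.mul_assoc]
          rw [nonsing_inv_mul_cancel_left _ _ hLdet, mul_nonsing_inv_cancel_left _ _ hLdet, hFF,
            Matrix.mul_one, ← Matrix.mul_assoc, hFF, Matrix.one_mul]
      _ = K * diagonal p * Kᵀ := by
          rw [hP, hKT, hKdef, hp, ← hQconj]
          simp only [Matrix.mul_assoc]
          rw [← Matrix.mul_assoc Qᵀ Q, hQ', Matrix.one_mul, ← Matrix.mul_assoc Qᵀ Q, hQ',
            Matrix.one_mul]
  have hp1 (i) : 1 < p i := by
    have hSeK : Se = K * diagonal (fun i => p i - 1) * star K := by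
      have : Se = (Sx + Se) - Sx := by abel
      rw [this, hPK, hSxK, ← diagonal_sub, diagonal_one, star_eq_conjTranspose,
        conjTranspose_eq_transpose_of_trivial, Matrix.mul_sub, Matrix.sub_mul, Matrix.mul_one]
    rw [hSeK, IsUnit.posDef_star_right_conjugate_iff ((isUnit_iff_isUnit_det _).2 hK),
      posDef_diagonal_iff] at hSe
    exact sub_pos.1 (hSe i)
  have hdP (i) : dP i ≠ 0 := by
    have := hp1 (σ.symm i)
    simp only [hp, Function.comp_apply, Equiv.apply_symm_apply] at this
    positivity
  set d : Fin n → ℝ := fun i => 1 - (p i)⁻¹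
  have hinv : (diagonal dP)⁻¹ = diagonal fun i => (dP i)⁻¹ :=
    inv_eq_right_inv (by simp [diagonal_mul_diagonal, hdP])
  have hdiag : Q * (1 - (diagonal dP)⁻¹) * Qᵀ = diagonal d := by
    rw [hinv, ← diagonal_one, diagonal_sub, hQconj]
    rfl
  rw [hdiag] at hsorted ⊢
  simp only [diagonal_apply_eq] at hsorted ⊢
  have hdpos (i) : 0 < d i := sub_pos.2 (inv_lt_one_of_one_lt₀ (hp1 i))
  set C := E * diagonal dD * Gᵀ with hC
  set J : Matrix (Fin m) (Fin n) ℝ :=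
    (1 : Matrix (Fin n) (Fin n) ℝ).submatrix (Fin.castLE hmn.le) id with hJ
  have hCdet : IsUnit C.det := by
    rw [hC, det_mul, det_mul, det_diagonal]
    refine (IsUnit.mul ?_ ?_).mul ?_
    · exact (isUnit_iff_isUnit_det _).1 (.of_mul_eq_one_right _ hE)
    · exact isUnit_iff_ne_zero.2 (Finset.prod_pos fun i _ => hdD i).ne'
    · rw [det_transpose]
      exact (isUnit_iff_isUnit_det _).1 (.of_mul_eq_one_right _ hG)
  have hM : Mᵀ = Gᵀ * J * Q := by
    rw [hMdef, transpose_mul, transpose_transpose]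
    congr 1
    ext i j
    simp only [transpose_apply, of_apply, hJ, mul_apply, submatrix_apply, one_apply, id_eq]
    split_ifs with h
    · rw [Finset.sum_eq_single ⟨j, h⟩]
      · simp
      · intro k _ hk
        rw [if_neg, mul_zero]
        intro hkj
        exact hk (Fin.ext (congrArg Fin.val hkj :))
      · simp
    · symm
      refine Finset.sum_eq_zero fun k _ => ?_
      rw [if_neg, mul_zero]
      rintro rfl
      exact h k.2
  have hTK : T * K = C * J := by
    rw [hT, hKdef, hM, hC]
    simp only [Matrix.mul_assoc]
    rw [← Matrix.mul_assoc Fᵀ, hF, Matrix.one_mul, nonsing_inv_mul_cancel_left _ _ hLdet,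
      ← Matrix.mul_assoc Upᵀ, hUp, Matrix.one_mul, hQQ, Matrix.mul_one]
  have hJd (x : Fin n → ℝ) : J * diagonal x * Jᵀ = diagonal (x ∘ Fin.castLE hmn.le) := by
    ext i j
    simp +contextual [hJ, mul_apply, one_apply, diagonal_apply]
  have hTrank : T.rank = m := by
    refine le_antisymm (by simpa using T.rank_le_card_height) ?_
    have hCJ : T * (K * Jᵀ) = C := by
      have hJJ : J * Jᵀ = 1 := by simpa using hJd 1
      rw [← Matrix.mul_assoc, hTK, Matrix.mul_assoc, hJJ, Matrix.mul_one]
    calc m = C.rank := by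
          rw [rank_of_isUnit _ ((isUnit_iff_isUnit_det _).2 hCdet), Fintype.card_fin]
      _ ≤ T.rank := hCJ ▸ rank_mul_le_left _ _
  have hvalue : ((1 : Matrix (Fin m) (Fin m) ℝ) + (1 / 2 : ℝ) • Wmat Sx Se T).det
      = ((2 : ℝ) ^ m)⁻¹ * ∏ i : Fin m, (1 + 1 / d (Fin.castLE hmn.le i)) := by
    obtain ⟨hpos, heq⟩ := det_one_add_half_Wmat_s8 hSx hSe hTrank hK hp1 hSxK hPK
    have hdet (x : Fin n → ℝ) : (T * K * diagonal x * (T * K)ᵀ).det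
        = C.det * (∏ i, x (Fin.castLE hmn.le i)) * C.det := by
      have : T * K * diagonal x * (T * K)ᵀ = C * (J * diagonal x * Jᵀ) * Cᵀ := by
        rw [hTK, transpose_mul]
        simp only [Matrix.mul_assoc]
      rw [this, hJd, det_mul, det_mul, det_transpose, det_diagonal]
      rfl
    refine mul_right_cancel₀ hpos.ne' (heq.trans ?_)
    rw [hdet, hdet]
    have : ∏ i : Fin m, (1 + d (Fin.castLE hmn.le i))
        = (∏ i : Fin m, (1 + 1 / d (Fin.castLE hmn.le i))) * ∏ i, d (Fin.castLE hmn.le i) := by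
      rw [← Finset.prod_mul_distrib]
      refine Finset.prod_congr rfl fun i _ => ?_
      rw [add_mul, one_mul, one_div_mul_cancel (hdpos _).ne', add_comm]
    change _ * (_ * (∏ i : Fin m, (1 + d (Fin.castLE hmn.le i))) * _) = _
    rw [this]
    ring
  refine ⟨hTrank, fun T' hT' => ?_, hvalue⟩
  obtain ⟨hpos, heq⟩ := det_one_add_half_Wmat_s8 hSx hSe hT' hK hp1 hSxK hPK
  refine le_of_mul_le_mul_right ?_ hpos
  rw [heq, hvalue, mul_assoc]
  exact mul_le_mul_of_nonneg_left (det_mul_diagonal_one_add_le hmn.le hsorted hdpos _)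
    (by positivity)
end

section
/- The n×n matrix Σy|z := Σx + Σe − Σx Tᵀ (T Σx Tᵀ)⁻¹ T Σx is symmetric positive definite. -/
open Matrix

/-- With the convention that a singular matrix has inverse `0`, the identity `A⁻¹ A A⁻¹ = A⁻¹`
holds for every square matrix. -/
theorem Matrix.nonsing_inv_mul_mul_nonsing_inv {m R : Type*} [Fintype m] [DecidableEq m]
    [CommRing R] (A : Matrix m m R) : A⁻¹ * A * A⁻¹ = A⁻¹ := by
  by_cases h : IsUnit A.det
  · rw [nonsing_inv_mul _ h, Matrix.one_mul]
  · simp [nonsing_inv_apply_not_isUnit _ h]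

/-- The conditional covariance `S - S Tᵀ (T S Tᵀ)⁻¹ T S` is positive semidefinite: it equals
`Pᵀ S P` with `P = 1 - Tᵀ (T S Tᵀ)⁻¹ T S`. -/
theorem Matrix.PosSemidef.sub_mul_inv_mul {m n : Type*} [Fintype m] [Fintype n]
    [DecidableEq m] [DecidableEq n] {S : Matrix n n ℝ} (hS : S.PosSemidef) (T : Matrix m n ℝ) :
    (S - S * Tᵀ * (T * S * Tᵀ)⁻¹ * T * S).PosSemidef := by
  have hSt : Sᵀ = S := by simpa using hS.isHermitian.eq
  have hK := nonsing_inv_mul_mul_nonsing_inv (T * S * Tᵀ)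
  have hKt : ((T * S * Tᵀ)⁻¹)ᵀ = (T * S * Tᵀ)⁻¹ := by
    simp [transpose_nonsing_inv, transpose_mul, hSt, Matrix.mul_assoc]
  generalize (T * S * Tᵀ)⁻¹ = K at hK hKt ⊢
  have hP := hS.conjTranspose_mul_mul_same (1 - Tᵀ * K * T * S)
  have hmid : S * Tᵀ * K * T * S * (Tᵀ * K * T * S) = S * Tᵀ * K * T * S := by
    calc _ = S * Tᵀ * (K * (T * S * Tᵀ) * K) * T * S := by simp only [Matrix.mul_assoc]
      _ = _ := by rw [hK]
  have hPt : (1 - Tᵀ * K * T * S)ᴴ = 1 - S * Tᵀ * K * T := by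
    simp [conjTranspose_eq_transpose_of_trivial, transpose_mul, hSt, hKt, Matrix.mul_assoc]
  rwa [hPt, Matrix.sub_mul, Matrix.one_mul, Matrix.mul_sub, Matrix.mul_one, Matrix.sub_mul, hmid,
    ← Matrix.mul_assoc, ← Matrix.mul_assoc, ← Matrix.mul_assoc, sub_self, sub_zero] at hP

/-- `Σy|z := Σx + Σe − Σx Tᵀ (T Σx Tᵀ)⁻¹ T Σx` is symmetric positive definite. -/
theorem sigma_y_given_z_posDef (m n : ℕ) (hm : 0 < m) (hmn : m < n)
    (Sx Se : Matrix (Fin n) (Fin n) ℝ) (hSx : Sx.PosDef) (hSe : Se.PosDef)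
    (T : Matrix (Fin m) (Fin n) ℝ) (hT : T.rank = m) :
    (Sx + Se - Sx * Tᵀ * (T * Sx * Tᵀ)⁻¹ * T * Sx).PosDef := by
  rw [add_sub_right_comm]
  exact PosDef.posSemidef_add (hSx.posSemidef.sub_mul_inv_mul T) hSe
end

section
/- The m×m matrix Aᵀ Σy|z⁻¹ A is symmetric positive definite. -/
open Matrix

namespace Matrix

variable {ι κ : Type*} [Fintype ι] [Fintype κ]

theorem vecMul_injective_of_rank_eq_card {K : Type*} [Field K] {T : Matrix κ ι K}
    (hT : T.rank = Fintype.card κ) : Function.Injective T.vecMul := by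
  rw [vecMul_injective_iff, linearIndependent_iff_card_eq_finrank_span, ← hT,
    rank_eq_finrank_span_row]
  rfl

variable [DecidableEq κ] {S : Matrix ι ι ℝ} {T : Matrix κ ι ℝ}

/-- The conditional covariance `S - S Tᵀ (T S Tᵀ)⁻¹ T S` is the congruence of `S` by
`1 - S Tᵀ (T S Tᵀ)⁻¹ T`, hence positive semidefinite. -/
theorem PosSemidef.sub_mul_inv_mul_s14 (hS : S.PosSemidef) (hG : IsUnit (T * S * Tᵀ).det) :
    (S - S * Tᵀ * (T * S * Tᵀ)⁻¹ * T * S).PosSemidef := by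
  classical
  have hSt : Sᵀ = S := by simpa using hS.isHermitian.eq
  have hGt : (T * S * Tᵀ)ᵀ = T * S * Tᵀ := by simp [hSt, Matrix.mul_assoc]
  have key := hS.mul_mul_conjTranspose_same (1 - S * Tᵀ * (T * S * Tᵀ)⁻¹ * T)
  have hBt : (S * Tᵀ * (T * S * Tᵀ)⁻¹ * T)ᵀ = Tᵀ * ((T * S * Tᵀ)⁻¹ * (T * S)) := by
    rw [transpose_mul, transpose_mul, transpose_mul, transpose_nonsing_inv, hGt, hSt,
      transpose_transpose]
  have hBSB : S * Tᵀ * (T * S * Tᵀ)⁻¹ * T * S * (Tᵀ * ((T * S * Tᵀ)⁻¹ * (T * S))) =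
      S * Tᵀ * (T * S * Tᵀ)⁻¹ * T * S := by
    calc _ = S * Tᵀ * (T * S * Tᵀ)⁻¹ * ((T * S * Tᵀ) * (T * S * Tᵀ)⁻¹) * (T * S) := by
          simp only [Matrix.mul_assoc]
      _ = _ := by rw [mul_nonsing_inv _ hG, Matrix.mul_one]; simp only [Matrix.mul_assoc]
  have hSB : S * (Tᵀ * ((T * S * Tᵀ)⁻¹ * (T * S))) = S * Tᵀ * (T * S * Tᵀ)⁻¹ * T * S := by
    simp only [Matrix.mul_assoc]
  rw [conjTranspose_eq_transpose_of_trivial, transpose_sub, transpose_one, hBt, Matrix.mul_sub,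
    Matrix.mul_one, Matrix.sub_mul, Matrix.one_mul, Matrix.sub_mul, hBSB, hSB, sub_self,
    sub_zero] at key
  exact key

end Matrix




/-- With `Σy|z := Σx + Σe − Σx Tᵀ (T Σx Tᵀ)⁻¹ T Σx` and `A := Σx Tᵀ (T Σx Tᵀ)⁻¹`, the
`m×m` matrix `Aᵀ Σy|z⁻¹ A` is symmetric positive definite. -/
theorem AtSA_posDef (m n : ℕ) (hm : 0 < m) (hmn : m < n)
    (Sx Se : Matrix (Fin n) (Fin n) ℝ) (hSx : Sx.PosDef) (hSe : Se.PosDef)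
    (T : Matrix (Fin m) (Fin n) ℝ) (hT : T.rank = m) :
    ((Sx * Tᵀ * (T * Sx * Tᵀ)⁻¹)ᵀ *
        (Sx + Se - Sx * Tᵀ * (T * Sx * Tᵀ)⁻¹ * T * Sx)⁻¹ *
          (Sx * Tᵀ * (T * Sx * Tᵀ)⁻¹)).PosDef := by
  have hTinj : Function.Injective T.vecMul :=
    vecMul_injective_of_rank_eq_card (by rw [hT, Fintype.card_fin])
  have hG : (T * Sx * Tᵀ).PosDef := by
    simpa using hSx.mul_mul_conjTranspose_same hTinj
  have hGu : IsUnit (T * Sx * Tᵀ).det := (isUnit_iff_isUnit_det _).mp hG.isUnit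
  have hS : (Sx + Se - Sx * Tᵀ * (T * Sx * Tᵀ)⁻¹ * T * Sx).PosDef := by
    rw [add_sub_right_comm]
    exact hSe.posSemidef_add (hSx.posSemidef.sub_mul_inv_mul_s14 hGu)
  have hTA : T * (Sx * Tᵀ * (T * Sx * Tᵀ)⁻¹) = 1 := by
    rw [← Matrix.mul_assoc, ← Matrix.mul_assoc, mul_nonsing_inv _ hGu]
  have hAinj : Function.Injective (Sx * Tᵀ * (T * Sx * Tᵀ)⁻¹).mulVec :=
    Function.LeftInverse.injective (g := T.mulVec) fun v => by
      rw [mulVec_mulVec, hTA, one_mulVec]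
  rw [← conjTranspose_eq_transpose_of_trivial (Sx * Tᵀ * (T * Sx * Tᵀ)⁻¹)]
  exact hS.inv.conjTranspose_mul_mul_same hAinj
end

section
/- P satisfies P = I_n + Λ⁻¹ Fᵀ Σe F Λ⁻¹; every diagonal entry of Λp is strictly greater than 1; and consequently Λ̂p := I_n − Λp⁻¹ is a diagonal positive definite matrix whose diagonal entries all lie in the open interval (0, 1). -/
open Matrix

/-- With `Σx = F Λ² Fᵀ` (`F` orthogonal, `Λ` diagonal positive),
`P := Λ⁻¹ Fᵀ (Σx + Σe) F Λ⁻¹` and `P = Up Λp Upᵀ` (`Up` orthogonal, `Λp` diagonal):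
`P = I_n + Λ⁻¹ Fᵀ Σe F Λ⁻¹`; every diagonal entry of `Λp` is strictly greater than `1`;
and consequently `Λ̂p := I_n − Λp⁻¹` is a diagonal positive definite matrix whose diagonal
entries all lie in the open interval `(0, 1)`. -/
theorem P_structure (n : ℕ) (hn : 0 < n)
    (Sx Se : Matrix (Fin n) (Fin n) ℝ) (hSx : Sx.PosDef) (hSe : Se.PosDef)
    (F : Matrix (Fin n) (Fin n) ℝ) (hF : Fᵀ * F = 1)
    (dL : Fin n → ℝ) (hdL : ∀ i, 0 < dL i)
    (hSxEig : Sx = F * (Matrix.diagonal dL) ^ 2 * Fᵀ)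
    (Up : Matrix (Fin n) (Fin n) ℝ) (hUp : Upᵀ * Up = 1)
    (dP : Fin n → ℝ)
    (hP : (Matrix.diagonal dL)⁻¹ * Fᵀ * (Sx + Se) * F * (Matrix.diagonal dL)⁻¹
        = Up * Matrix.diagonal dP * Upᵀ) :
    (Matrix.diagonal dL)⁻¹ * Fᵀ * (Sx + Se) * F * (Matrix.diagonal dL)⁻¹
        = 1 + (Matrix.diagonal dL)⁻¹ * Fᵀ * Se * F * (Matrix.diagonal dL)⁻¹ ∧
      (∀ i, 1 < dP i) ∧
      1 - (Matrix.diagonal dP)⁻¹ = Matrix.diagonal (fun i => 1 - (dP i)⁻¹) ∧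
      (1 - (Matrix.diagonal dP)⁻¹).PosDef ∧
      ∀ i, 0 < 1 - (dP i)⁻¹ ∧ 1 - (dP i)⁻¹ < 1 := by
  have hL : IsUnit (diagonal dL).det := by
    rw [det_diagonal]
    exact (Finset.prod_pos fun i _ => hdL i).ne'.isUnit
  have hDL : (diagonal dL)⁻¹ * diagonal dL = 1 := nonsing_inv_mul _ hL
  have hLD : diagonal dL * (diagonal dL)⁻¹ = 1 := mul_nonsing_inv _ hL
  have hDT : ((diagonal dL)⁻¹)ᵀ = (diagonal dL)⁻¹ := by
    rw [transpose_nonsing_inv, diagonal_transpose]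
  generalize (diagonal dL)⁻¹ = D at *
  have hPeq : D * Fᵀ * (Sx + Se) * F * D = 1 + D * Fᵀ * Se * F * D := by
    have hSxD : D * Fᵀ * Sx * F * D = 1 := by
      calc D * Fᵀ * Sx * F * D
          = (D * ((Fᵀ * F) * diagonal dL)) * (diagonal dL * (Fᵀ * F) * D) := by
            rw [hSxEig, pow_two]
            simp only [Matrix.mul_assoc]
        _ = 1 := by rw [hF, Matrix.one_mul, Matrix.mul_one, hDL, hLD, Matrix.one_mul]
    rw [Matrix.mul_add, Matrix.add_mul, Matrix.add_mul, hSxD]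
  have hdiag : diagonal dP = 1 + (F * D * Up)ᵀ * Se * (F * D * Up) := by
    calc diagonal dP = (Upᵀ * Up) * diagonal dP * (Upᵀ * Up) := by
          rw [hUp, Matrix.one_mul, Matrix.mul_one]
      _ = Upᵀ * (Up * diagonal dP * Upᵀ) * Up := by simp only [Matrix.mul_assoc]
      _ = Upᵀ * (1 + D * Fᵀ * Se * F * D) * Up := by rw [← hP, hPeq]
      _ = 1 + (F * D * Up)ᵀ * Se * (F * D * Up) := by
          rw [Matrix.mul_add, Matrix.add_mul, Matrix.mul_one, hUp]
          simp only [transpose_mul, hDT, Matrix.mul_assoc]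
  have hinv : (Upᵀ * diagonal dL * Fᵀ) * (F * D * Up) = 1 := by
    calc (Upᵀ * diagonal dL * Fᵀ) * (F * D * Up)
        = Upᵀ * (diagonal dL * ((Fᵀ * F) * D)) * Up := by simp only [Matrix.mul_assoc]
      _ = 1 := by rw [hF, Matrix.one_mul, hLD, Matrix.mul_one, hUp]
  have hinj : Function.Injective (F * D * Up).mulVec :=
    Function.LeftInverse.injective (g := (Upᵀ * diagonal dL * Fᵀ).mulVec) fun v => by
      rw [mulVec_mulVec, hinv, one_mulVec]
  have hpos : ((F * D * Up)ᵀ * Se * (F * D * Up)).PosDef := by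
    simpa only [conjTranspose_eq_transpose_of_trivial] using
      hSe.conjTranspose_mul_mul_same hinj
  have hone : ∀ i, 1 < dP i := fun i => by
    have hii := congrFun (congrFun hdiag i) i
    rw [diagonal_apply_eq, Matrix.add_apply, one_apply_eq] at hii
    rw [hii]
    exact lt_add_of_pos_right 1 hpos.diag_pos
  have hdPinv : (diagonal dP)⁻¹ = diagonal fun i => (dP i)⁻¹ := by
    refine inv_eq_right_inv ?_
    rw [diagonal_mul_diagonal, ← diagonal_one]
    exact congrArg diagonal (funext fun i => mul_inv_cancel₀ (zero_lt_one.trans (hone i)).ne')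
  have hsub : 1 - (diagonal dP)⁻¹ = diagonal fun i => 1 - (dP i)⁻¹ := by
    rw [hdPinv, ← diagonal_one, diagonal_sub]
  have hmem : ∀ i, 0 < 1 - (dP i)⁻¹ ∧ 1 - (dP i)⁻¹ < 1 := fun i =>
    ⟨sub_pos.2 (inv_lt_one_of_one_lt₀ (hone i)),
      sub_lt_self 1 (inv_pos.2 (zero_lt_one.trans (hone i)))⟩
  exact ⟨hPeq, hone, hsub, hsub ▸ PosDef.diagonal fun i => (hmem i).1, hmem⟩
end

section
/- Let M be an n×m real matrix with MᵀM = I_m, E an m×m real orthogonal matrix, D an m×m diagonal matrix with positive diagonal entries, and T := E D Mᵀ Upᵀ Λ⁻¹ Fᵀ. Then rank T = m and det(I_m + (1/2)·W(T)) = 2^{-m} · det(I_m + (Mᵀ Λ̂p M)⁻¹). -/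
open Matrix

section

variable {m n : ℕ}

/-- Cancel mutually inverse matrices at the head of a right-associated product. -/
theorem mul_cancel_left' {k l : Type*} [Fintype k] [Fintype l] [DecidableEq k] {o : Type*}
    {A : Matrix k l ℝ} {B : Matrix l k ℝ} (h : A * B = 1) (C : Matrix k o ℝ) :
    A * (B * C) = C := by
  rw [← Matrix.mul_assoc, h, Matrix.one_mul]

theorem rank_eq_of_mul_eq_one {S : Matrix (Fin m) (Fin n) ℝ} {R : Matrix (Fin n) (Fin m) ℝ}
    (h : S * R = 1) : S.rank = m := by
  refine le_antisymm (by simpa using S.rank_le_height) ?_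
  simpa [h] using rank_mul_le_left S R

theorem transpose_mul_one_sub_mul {M : Matrix (Fin n) (Fin m) ℝ} (hM : Mᵀ * M = 1)
    (A : Matrix (Fin n) (Fin n) ℝ) : Mᵀ * (1 - A) * M = 1 - Mᵀ * A * M := by
  rw [Matrix.mul_sub, Matrix.sub_mul, Matrix.mul_one, hM]

/-- If `G Gᵀ + Se = G diag(d) Gᵀ` with `Se` positive definite and `G` invertible, then
every entry of `d` exceeds one. -/
theorem one_lt_of_posDef_add_eq {Sx Se G H : Matrix (Fin n) (Fin n) ℝ} {d : Fin n → ℝ}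
    (hSe : Se.PosDef) (hHG : H * G = 1) (hSx : Sx = G * Gᵀ)
    (hadd : Sx + Se = G * diagonal d * Gᵀ) (i : Fin n) : 1 < d i := by
  have hGH : Gᵀ * Hᵀ = 1 := by rw [← transpose_mul, hHG, transpose_one]
  have hconj : H * Se * Hᵀ = diagonal (d - 1) := by
    have h1 : Se = G * diagonal d * Gᵀ - G * Gᵀ := by rw [← hadd, hSx, add_sub_cancel_left]
    rw [h1]
    simp only [Matrix.mul_sub, Matrix.sub_mul, Matrix.mul_assoc, mul_cancel_left' hHG, hGH,
      Matrix.mul_one]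
    rw [← diagonal_one, diagonal_sub]
    rfl
  have hinj : Function.Injective H.vecMul := by
    refine Function.LeftInverse.injective (g := G.vecMul) fun v => ?_
    simp [vecMul_vecMul, hHG]
  have hpos := hSe.mul_mul_conjTranspose_same hinj
  rw [conjTranspose_eq_transpose_of_trivial, hconj, posDef_diagonal_iff] at hpos
  simpa using hpos i

theorem posDef_transpose_mul_one_sub_inv_mul {d : Fin n → ℝ} (hd : ∀ i, 1 < d i)
    {M : Matrix (Fin n) (Fin m) ℝ} (hM : Mᵀ * M = 1) :
    (Mᵀ * (1 - (diagonal d)⁻¹) * M).PosDef := by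
  have hinv : (diagonal d)⁻¹ = diagonal d⁻¹ :=
    inv_eq_left_inv (by simp [diagonal_mul_diagonal, (zero_lt_one.trans (hd _)).ne'])
  have hdiag : (1 - (diagonal d)⁻¹).PosDef := by
    rw [hinv, ← diagonal_one, diagonal_sub, posDef_diagonal_iff]
    exact fun i => sub_pos.mpr (inv_lt_one_of_one_lt₀ (hd i))
  have hinj : Function.Injective M.mulVec := by
    refine Function.LeftInverse.injective (g := Mᵀ.mulVec) fun v => ?_
    rw [mulVec_mulVec, hM, one_mulVec]
  simpa using hdiag.conjTranspose_mul_mul_same hinj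

/-- The Woodbury formula for a left inverse of `D - M Mᵀ`. -/
theorem woodbury_mul {D D' : Matrix (Fin n) (Fin n) ℝ} {M : Matrix (Fin n) (Fin m) ℝ}
    {X : Matrix (Fin m) (Fin m) ℝ} (hD : D' * D = 1) (hX : X * (1 - Mᵀ * D' * M) = 1) :
    (D' + D' * M * X * Mᵀ * D') * (D - M * Mᵀ) = 1 := by
  have hXA : X * (Mᵀ * (D' * M)) = X - 1 := by
    rw [Matrix.mul_sub, Matrix.mul_one] at hX
    rw [← hX, ← Matrix.mul_assoc Mᵀ, sub_sub_cancel]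
  calc (D' + D' * M * X * Mᵀ * D') * (D - M * Mᵀ)
      = D' * D + D' * M * X * Mᵀ * (D' * D) - D' * M * Mᵀ
        - D' * M * (X * (Mᵀ * (D' * M))) * Mᵀ := by
        simp only [Matrix.add_mul, Matrix.mul_sub, Matrix.mul_assoc]
        abel
    _ = 1 := by
        rw [hD, hXA]
        simp only [Matrix.mul_sub, Matrix.sub_mul, Matrix.mul_one, Matrix.mul_assoc]
        abel

theorem transpose_mul_woodbury_mul {D' : Matrix (Fin n) (Fin n) ℝ}
    {M : Matrix (Fin n) (Fin m) ℝ} {X : Matrix (Fin m) (Fin m) ℝ}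
    (hX : X * (1 - Mᵀ * D' * M) = 1) :
    Mᵀ * (D' + D' * M * X * Mᵀ * D') * M = X - 1 := by
  have hX' := mul_eq_one_comm.mp hX
  have hXA : X * (Mᵀ * D' * M) = X - 1 := by
    rw [Matrix.mul_sub, Matrix.mul_one] at hX
    rw [← hX, sub_sub_cancel]
  have hAX : (Mᵀ * D' * M) * X = X - 1 := by
    rw [Matrix.sub_mul, Matrix.one_mul] at hX'
    rw [← hX', sub_sub_cancel]
  calc Mᵀ * (D' + D' * M * X * Mᵀ * D') * M
      = Mᵀ * D' * M + (Mᵀ * D' * M) * X * (Mᵀ * D' * M) := by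
        simp only [Matrix.mul_add, Matrix.add_mul, Matrix.mul_assoc]
    _ = X - 1 := by
        rw [hAX, Matrix.sub_mul, hXA, Matrix.one_mul, add_sub_cancel]

/-- In the coordinates given by `G`, which turn `Sx` into the identity and `Sx + Se` into `D`,
`Wmat Sx Se (K Mᵀ G⁻¹)` is conjugate to `Mᵀ (D - M Mᵀ)⁻¹ M`. -/
theorem Wmat_eq_conj {Sx Se G H D Q : Matrix (Fin n) (Fin n) ℝ}
    {M : Matrix (Fin n) (Fin m) ℝ} {K K' : Matrix (Fin m) (Fin m) ℝ}
    {S : Matrix (Fin m) (Fin n) ℝ} (hHG : H * G = 1) (hSx : Sx = G * Gᵀ)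
    (hadd : Sx + Se = G * D * Gᵀ) (hM : Mᵀ * M = 1) (hKK : K * K' = 1)
    (hS : S = K * Mᵀ * H) (hQ : Q * (D - M * Mᵀ) = 1) :
    Wmat Sx Se S = K * (Mᵀ * Q * M) * K' := by
  have hGH : Gᵀ * Hᵀ = 1 := by rw [← transpose_mul, hHG, transpose_one]
  have hHG' : Hᵀ * Gᵀ = 1 := mul_eq_one_comm.mp hGH
  have hK'K : K' * K = 1 := mul_eq_one_comm.mp hKK
  have hKK't : Kᵀ * K'ᵀ = 1 := by rw [← transpose_mul, hK'K, transpose_one]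
  have hSSx : S * Sx = K * Mᵀ * Gᵀ := by
    rw [hS, hSx]
    simp only [Matrix.mul_assoc, mul_cancel_left' hHG]
  have hSxS : Sx * Sᵀ = G * M * Kᵀ := by
    rw [hS, hSx]
    simp only [transpose_mul, transpose_transpose, Matrix.mul_assoc, mul_cancel_left' hGH]
  have hinv : (S * Sx * Sᵀ)⁻¹ = K'ᵀ * K' := by
    refine inv_eq_right_inv ?_
    rw [hSSx, hS]
    simp only [transpose_mul, transpose_transpose, Matrix.mul_assoc, mul_cancel_left' hGH,
      mul_cancel_left' hM, mul_cancel_left' hKK't, hKK]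
  have hmid : (Sx + Se - Sx * Sᵀ * (S * Sx * Sᵀ)⁻¹ * S * Sx)⁻¹ = Hᵀ * Q * H := by
    refine inv_eq_left_inv ?_
    have : Sx + Se - Sx * Sᵀ * (S * Sx * Sᵀ)⁻¹ * S * Sx = G * (D - M * Mᵀ) * Gᵀ := by
      rw [hinv, Matrix.mul_assoc _ S, hSSx, hSxS, hadd]
      simp only [Matrix.mul_sub, Matrix.sub_mul, Matrix.mul_assoc, mul_cancel_left' hKK't,
        mul_cancel_left' hK'K]
    rw [this]
    simp only [Matrix.mul_assoc, mul_cancel_left' hHG, mul_cancel_left' hQ, hHG']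
  rw [Wmat, hmid, hinv, hSSx, Matrix.mul_assoc _ Sx, hSxS]
  simp only [Matrix.mul_assoc, mul_cancel_left' hHG, mul_cancel_left' hGH,
    mul_cancel_left' hKK't]

end

/-- With `Σx = F Λ² Fᵀ`, `P := Λ⁻¹ Fᵀ (Σx + Σe) F Λ⁻¹ = Up Λp Upᵀ` and
`Λ̂p := I_n − Λp⁻¹`: for `M` with orthonormal columns, `E` orthogonal, `D` diagonal
positive and `T := E D Mᵀ Upᵀ Λ⁻¹ Fᵀ`, one has `rank T = m` and
`det(I_m + (1/2) W(T)) = 2^{-m} · det(I_m + (Mᵀ Λ̂p M)⁻¹)`. -/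
theorem J_eq_G (m n : ℕ) (hm : 0 < m) (hmn : m < n)
    (Sx Se : Matrix (Fin n) (Fin n) ℝ) (hSx : Sx.PosDef) (hSe : Se.PosDef)
    (F : Matrix (Fin n) (Fin n) ℝ) (hF : Fᵀ * F = 1)
    (dL : Fin n → ℝ) (hdL : ∀ i, 0 < dL i)
    (hSxEig : Sx = F * (Matrix.diagonal dL) ^ 2 * Fᵀ)
    (Up : Matrix (Fin n) (Fin n) ℝ) (hUp : Upᵀ * Up = 1)
    (dP : Fin n → ℝ)
    (hP : (Matrix.diagonal dL)⁻¹ * Fᵀ * (Sx + Se) * F * (Matrix.diagonal dL)⁻¹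
        = Up * Matrix.diagonal dP * Upᵀ)
    (M : Matrix (Fin n) (Fin m) ℝ) (hM : Mᵀ * M = 1)
    (E : Matrix (Fin m) (Fin m) ℝ) (hE : Eᵀ * E = 1)
    (dD : Fin m → ℝ) (hdD : ∀ i, 0 < dD i)
    (T : Matrix (Fin m) (Fin n) ℝ)
    (hT : T = E * Matrix.diagonal dD * Mᵀ * Upᵀ * (Matrix.diagonal dL)⁻¹ * Fᵀ) :
    T.rank = m ∧
      ((1 : Matrix (Fin m) (Fin m) ℝ) + (1 / 2 : ℝ) • Wmat Sx Se T).det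
        = ((2 : ℝ) ^ m)⁻¹ *
          ((1 : Matrix (Fin m) (Fin m) ℝ)
            + (Mᵀ * (1 - (Matrix.diagonal dP)⁻¹) * M)⁻¹).det := by
  have hL : (diagonal dL)⁻¹ = diagonal dL⁻¹ :=
    inv_eq_left_inv (by simp [diagonal_mul_diagonal, (hdL _).ne'])
  have hLL : diagonal dL⁻¹ * diagonal dL = 1 := by
    simp [diagonal_mul_diagonal, (hdL _).ne']
  have hLL' : diagonal dL * diagonal dL⁻¹ = 1 := mul_eq_one_comm.mp hLL
  have hF' : F * Fᵀ = 1 := mul_eq_one_comm.mp hF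
  have hUp' : Up * Upᵀ = 1 := mul_eq_one_comm.mp hUp
  have hDD : diagonal dD * diagonal dD⁻¹ = 1 := by
    simp [diagonal_mul_diagonal, (hdD _).ne']
  rw [hL] at hP hT
  have hHG : (Upᵀ * diagonal dL⁻¹ * Fᵀ) * (F * diagonal dL * Up) = 1 := by
    simp only [Matrix.mul_assoc, mul_cancel_left' hF, mul_cancel_left' hLL, hUp]
  have hGG : Sx = (F * diagonal dL * Up) * (F * diagonal dL * Up)ᵀ := by
    rw [hSxEig]
    simp only [transpose_mul, diagonal_transpose, pow_two, Matrix.mul_assoc,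
      mul_cancel_left' hUp']
  have hGDG : Sx + Se = (F * diagonal dL * Up) * diagonal dP * (F * diagonal dL * Up)ᵀ := by
    calc Sx + Se = F * diagonal dL * (diagonal dL⁻¹ * Fᵀ * (Sx + Se) * F * diagonal dL⁻¹)
          * diagonal dL * Fᵀ := by
          simp only [Matrix.mul_assoc, mul_cancel_left' hLL, mul_cancel_left' hLL',
            mul_cancel_left' hF', hF', Matrix.mul_one]
      _ = _ := by
          rw [hP]
          simp only [transpose_mul, diagonal_transpose, Matrix.mul_assoc]
  have hKK : (E * diagonal dD) * (diagonal dD⁻¹ * Eᵀ) = 1 := by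
    simp only [Matrix.mul_assoc, mul_cancel_left' hDD, mul_eq_one_comm.mp hE]
  have hTK : T = (E * diagonal dD) * Mᵀ * (Upᵀ * diagonal dL⁻¹ * Fᵀ) := by
    rw [hT]; simp only [Matrix.mul_assoc]
  generalize F * diagonal dL * Up = G at hHG hGG hGDG
  generalize Upᵀ * diagonal dL⁻¹ * Fᵀ = H at hHG hTK
  generalize E * diagonal dD = K at hKK hTK
  generalize diagonal dD⁻¹ * Eᵀ = K' at hKK
  have hdP : ∀ i, 1 < dP i := one_lt_of_posDef_add_eq hSe hHG hGG hGDG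
  have hX : (1 - Mᵀ * (diagonal dP)⁻¹ * M)⁻¹ * (1 - Mᵀ * (diagonal dP)⁻¹ * M) = 1 := by
    rw [← transpose_mul_one_sub_mul hM]
    exact nonsing_inv_mul _ ((isUnit_iff_isUnit_det _).mp
      (posDef_transpose_mul_one_sub_inv_mul hdP hM).isUnit)
  have hDP : (diagonal dP)⁻¹ * diagonal dP = 1 :=
    nonsing_inv_mul _ (by
      rw [det_diagonal]
      exact (Finset.prod_ne_zero_iff.mpr fun i _ => (zero_lt_one.trans (hdP i)).ne').isUnit)
  refine ⟨rank_eq_of_mul_eq_one (S := T) (R := G * M * K') ?_, ?_⟩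
  · rw [hTK]
    simp only [Matrix.mul_assoc, mul_cancel_left' hHG, mul_cancel_left' hM, hKK]
  · rw [Wmat_eq_conj hHG hGG hGDG hM hKK hTK (woodbury_mul hDP hX),
      transpose_mul_woodbury_mul hX, transpose_mul_one_sub_mul hM]
    generalize (1 - Mᵀ * (diagonal dP)⁻¹ * M)⁻¹ = X
    calc (1 + (1 / 2 : ℝ) • (K * (X - 1) * K')).det
        = (K * ((1 / 2 : ℝ) • (1 + X)) * K').det := by
          congr 1
          rw [Matrix.mul_smul, Matrix.smul_mul, Matrix.mul_sub, Matrix.sub_mul, Matrix.mul_add,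
            Matrix.add_mul, Matrix.mul_one, hKK]
          module
      _ = ((1 / 2 : ℝ) • (1 + X)).det := by
          rw [det_mul_right_comm, hKK, Matrix.one_mul]
      _ = _ := by
          rw [det_smul, Fintype.card_fin, one_div, inv_pow]
end
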